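/- Let f : ℝ^d → ℝ^d be continuous with f(0) = 0, and let V : ℝ^d → ℝ be continuous with V(0) = 0, V(x) > 0 for all x ≠ 0, V radially unbounded (V(x) → ∞ as ‖x‖ → ∞), and V(f(x)) < V(x) for all x ≠ 0. Then the discrete-time system x_{k+1} = f(x_k) is globally attractive: for every initial condition x_0 ∈ ℝ^d, the iterates x_k = f^{[k]}(x_0) converge to 0 as k → ∞. -/

import Mathlib

/-- Discrete-time Lyapunov theorem (global attractivity): if `V` is a continuous,
positive definite, radially unbounded function strictly decreasing along the
dynamics `f` away from the origin, then every trajectory of `x_{k+1} = f(x_k)`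
converges to the origin. -/
theorem lyapunov_global_attractivity {d : ℕ}
    (f : EuclideanSpace ℝ (Fin d) → EuclideanSpace ℝ (Fin d))
    (hf : Continuous f) (hf0 : f 0 = 0)
    (V : EuclideanSpace ℝ (Fin d) → ℝ) (hV : Continuous V)
    (hV0 : V 0 = 0)
    (hVpos : ∀ x : EuclideanSpace ℝ (Fin d), x ≠ 0 → 0 < V x)
    (hVrad : ∀ c : ℝ, ∃ R : ℝ, ∀ x : EuclideanSpace ℝ (Fin d), R < ‖x‖ → c < V x)
    (hdec : ∀ x : EuclideanSpace ℝ (Fin d), x ≠ 0 → V (f x) < V x) :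
    ∀ x0 : EuclideanSpace ℝ (Fin d),
      Filter.Tendsto (fun k => f^[k] x0) Filter.atTop (nhds 0) := by
  intro x0
  have hnn : ∀ x, 0 ≤ V x := by
    intro x
    by_cases h : x = 0
    · rw [h, hV0]
    · exact (hVpos x h).le
  have hle : ∀ x, V (f x) ≤ V x := by
    intro x
    by_cases h : x = 0
    · rw [h, hf0]
    · exact (hdec x h).le
  have hanti : Antitone (fun k => V (f^[k] x0)) := by
    apply antitone_nat_of_succ_le
    intro n
    rw [Function.iterate_succ_apply']
    exact hle _
  have hbdd : BddBelow (Set.range (fun k => V (f^[k] x0))) := by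
    refine ⟨0, ?_⟩
    rintro _ ⟨k, rfl⟩
    exact hnn _
  have hlim := tendsto_atTop_ciInf hanti hbdd
  obtain ⟨R, hR⟩ := hVrad (V x0)
  have hmem : ∀ k, f^[k] x0 ∈ Metric.closedBall (0 : EuclideanSpace ℝ (Fin d)) R := by
    intro k
    rw [mem_closedBall_zero_iff]
    by_contra h
    have h1 := hR _ (not_le.mp h)
    have h2 : V (f^[k] x0) ≤ V x0 := hanti (Nat.zero_le k)
    linarith
  apply Filter.tendsto_of_subseq_tendsto
  intro ns hns
  obtain ⟨a, -, φ, hφ, ha⟩ :=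
    (isCompact_closedBall (0 : EuclideanSpace ℝ (Fin d)) R).tendsto_subseq
      (fun n => hmem (ns n))
  refine ⟨φ, ?_⟩
  have hsub : Filter.Tendsto (fun n => ns (φ n)) Filter.atTop Filter.atTop :=
    hns.comp hφ.tendsto_atTop
  have e1 := tendsto_nhds_unique ((hV.tendsto a).comp ha) (hlim.comp hsub)
  have h2 : Filter.Tendsto (fun n => V (f (f^[ns (φ n)] x0))) Filter.atTop (nhds (V (f a))) :=
    ((hV.comp hf).tendsto a).comp ha
  have h3 := hlim.comp ((Filter.tendsto_add_atTop_nat 1).comp hsub)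
  have e2 : V (f a) = ⨅ i, V (f^[i] x0) := by
    refine tendsto_nhds_unique h2 (h3.congr ?_)
    intro n
    simp only [Function.comp_apply, Function.iterate_succ_apply']
  have ha0 : a = 0 := by
    by_contra h
    have := hdec a h
    rw [e1, e2] at this
    exact lt_irrefl _ this
  rw [ha0] at ha
  exact ha
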